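/- arXiv:2602.10971 — 4 statements merged into one kernel-verified Lean document; each statement's English description precedes it below -/
import Mathlib

section
/- Let a, b > 0 be real numbers with a·b ≥ 1. If a natural number n satisfies n ≤ a·log(1 + b·n), then n ≤ 2a·log(1 + a·b). -/
/-- A real `x` with `x ≤ log (1 + c * x)` is at most `2 * log (1 + c)`. -/
theorem le_two_mul_log_of_le_log {c x : ℝ} (hc : 0 < c) (hx : 0 ≤ x)
    (h : x ≤ Real.log (1 + c * x)) : x ≤ 2 * Real.log (1 + c) := by
  by_contra! hlt
  have hexp : Real.exp x ≤ 1 + c * x := (Real.le_log_iff_exp_le (by positivity)).1 h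
  have hlog : Real.log (1 + c) ≤ (1 + c) / 2 - 1 + Real.log 2 := by
    have := Real.log_le_sub_one_of_pos (show 0 < (1 + c) / 2 by positivity)
    rw [Real.log_div (by positivity) (by norm_num)] at this
    linarith
  have hlog2 := Real.log_two_lt_d9
  have hsplit : Real.exp x = (1 + c) ^ 2 * Real.exp (x - 2 * Real.log (1 + c)) := by
    rw [← Real.exp_log (show 0 < (1 + c) ^ 2 by positivity), ← Real.exp_add, Real.log_pow]
    congr 1
    push_cast
    ring
  have hlower := mul_le_mul_of_nonneg_left
    (Real.add_one_le_exp (x - 2 * Real.log (1 + c))) (sq_nonneg (1 + c))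
  have hgap : 0 < (1 + c + c ^ 2) * (x - 2 * Real.log (1 + c)) :=
    mul_pos (by positivity) (by linarith)
  have hconst : 0 < c * (2 + c - 2 * Real.log (1 + c)) := mul_pos hc (by linarith)
  nlinarith

/-- Lemma `solve-log`: if `a, b > 0` with `a·b ≥ 1` and a natural number `n`
satisfies `n ≤ a·log(1 + b·n)`, then `n ≤ 2a·log(1 + a·b)`. -/
theorem solve_log (a b : ℝ) (ha : 0 < a) (hb : 0 < b) (hab : 1 ≤ a * b)
    (n : ℕ) (h : (n : ℝ) ≤ a * Real.log (1 + b * n)) :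
    (n : ℝ) ≤ 2 * a * Real.log (1 + a * b) := by
  have hn : a * b * (n / a) = b * n := by field_simp
  have key : (n : ℝ) / a ≤ 2 * Real.log (1 + a * b) :=
    le_two_mul_log_of_le_log (by positivity) (by positivity)
      (by rwa [hn, div_le_iff₀' ha])
  rw [div_le_iff₀' ha] at key
  linarith
end

section
/- Let (X_t)_{t≥1} and (β_t)_{t≥1} be sequences of nonnegative real numbers such that (β_t) is nondecreasing, and let c ≥ 0. Suppose that for every t ≥ 1, X_t^2 ≤ β_t^2 + c · max_{1 ≤ s ≤ t} X_s. Then for every t ≥ 1, X_t ≤ β_t + c. -/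
/-- Maximum-involved self-bounding inequality: if `(X_t)` and `(β_t)` are nonnegative,
`(β_t)` is nondecreasing, `c ≥ 0`, and for every `t ≥ 1` one has
`X_t² ≤ β_t² + c · max_{1 ≤ s ≤ t} X_s`, then `X_t ≤ β_t + c` for every `t ≥ 1`. -/
theorem max_self_bounding (X β : ℕ → ℝ) (c : ℝ)
    (hX : ∀ t, 0 ≤ X t) (hβ : ∀ t, 0 ≤ β t) (hβmono : Monotone β) (hc : 0 ≤ c)
    (h : ∀ t, ∀ ht : 1 ≤ t,
      X t ^ 2 ≤ β t ^ 2 + c * (Finset.Icc 1 t).sup' (Finset.nonempty_Icc.mpr ht) X) :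
    ∀ t, 1 ≤ t → X t ≤ β t + c := by
  intro t ht
  obtain ⟨z, hz, hmax⟩ :=
    Finset.exists_mem_eq_sup' (Finset.nonempty_Icc.mpr ht) X
  obtain ⟨hz1, hzt⟩ := Finset.mem_Icc.mp hz
  have hle : ∀ s ∈ Finset.Icc 1 t, X s ≤ X z := fun s hs =>
    hmax ▸ Finset.le_sup' X hs
  have hsup : (Finset.Icc 1 z).sup' (Finset.nonempty_Icc.mpr hz1) X ≤ X z :=
    Finset.sup'_le _ _ fun s hs => hle s (Finset.Icc_subset_Icc_right hzt hs)
  have hquad : X z ^ 2 ≤ β z ^ 2 + c * X z :=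
    (h z hz1).trans (by gcongr)
  have hXz : X z ≤ β z + c := by
    by_contra! hlt
    have hpos : 0 < X z := by linarith [hβ z]
    nlinarith [mul_pos (sub_pos.mpr hlt) hpos,
      mul_nonneg (hβ z) (sub_pos.mpr hlt).le, mul_nonneg (hβ z) hc]
  linarith [hle t (Finset.mem_Icc.mpr ⟨ht, le_rfl⟩), hβmono hzt]
end

section
/- Let Z ⊆ ℝ be a bounded interval, R ≥ 0, and let μ : ℝ → ℝ be strictly increasing and R-self-concordant on Z. Then for any z₁, z₂ ∈ Z and any z ∈ {z₁, z₂}, the integral ∫₀¹ μ̇(z₁ + v(z₂ − z₁)) dv is at least μ̇(z) / (1 + R·|z₁ − z₂|). -/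
/-- If `|f'| ≤ a * f` on `[0, 1]`, then `f 0` is at most `1 + a` times the mean of `f`. -/
theorem left_le_one_add_mul_integral_of_abs_deriv_le {f f' : ℝ → ℝ} {a : ℝ}
    (hf : ∀ v ∈ Set.Icc (0 : ℝ) 1, HasDerivAt f (f' v) v)
    (hf' : ∀ v ∈ Set.Icc (0 : ℝ) 1, |f' v| ≤ a * f v) :
    f 0 ≤ (1 + a) * ∫ v in (0 : ℝ)..1, f v := by
  have hg : ∀ v ∈ Set.Icc (0 : ℝ) 1,
      HasDerivAt (fun v => (v - 1) * f v) (1 * f v + (v - 1) * f' v) v :=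
    fun v hv => ((hasDerivAt_id v).sub_const 1).mul (hf v hv)
  have hcont : ContinuousOn f (Set.Icc 0 1) :=
    fun v hv => (hf v hv).continuousAt.continuousWithinAt
  have key := intervalIntegral.sub_le_integral_of_hasDeriv_right_of_le zero_le_one
    (fun v hv => (hg v hv).continuousAt.continuousWithinAt)
    (fun v hv => (hg v (Set.Ioo_subset_Icc_self hv)).hasDerivWithinAt)
    (φ := fun v => (1 + a) * f v)
    (continuousOn_const.mul hcont).integrableOn_Icc
    (fun v hv => by
      have hb := hf' v (Set.Ioo_subset_Icc_self hv)
      have h1 := (abs_le.mp hb).1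
      nlinarith [mul_nonneg hv.1.le ((abs_nonneg _).trans hb),
        mul_nonneg (sub_nonneg.mpr hv.2.le) (neg_le_iff_add_nonneg.mp h1)])
  rw [intervalIntegral.integral_const_mul] at key
  linarith


/-- Self-concordance control (Lemma 11, first part): if `Z` is a bounded interval,
`R ≥ 0`, and `μ : ℝ → ℝ` is strictly increasing and `R`-self-concordant on `Z`
(twice differentiable on `Z` with `|μ''| ≤ R·μ'` on `Z`), then for `z₁, z₂ ∈ Z` and
`z ∈ {z₁, z₂}` one has `∫₀¹ μ'(z₁ + v(z₂ − z₁)) dv ≥ μ'(z) / (1 + R·|z₁ − z₂|)`. -/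
theorem self_concordance_integral_lower_bound
    (Z : Set ℝ) (hZconv : Convex ℝ Z) (hZbdd : Bornology.IsBounded Z)
    (R : ℝ) (hR : 0 ≤ R) (μ : ℝ → ℝ) (hmono : StrictMono μ)
    (hd1 : ∀ z ∈ Z, DifferentiableAt ℝ μ z)
    (hd2 : ∀ z ∈ Z, DifferentiableAt ℝ (deriv μ) z)
    (hsc : ∀ z ∈ Z, |deriv (deriv μ) z| ≤ R * deriv μ z)
    (z₁ : ℝ) (h₁ : z₁ ∈ Z) (z₂ : ℝ) (h₂ : z₂ ∈ Z)
    (z : ℝ) (hz : z = z₁ ∨ z = z₂) :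
    deriv μ z / (1 + R * |z₁ - z₂|) ≤ ∫ v in (0:ℝ)..1, deriv μ (z₁ + v * (z₂ - z₁)) := by
  have ha : 0 < 1 + R * |z₁ - z₂| := by positivity
  rw [div_le_iff₀' ha]
  have hmem : ∀ v ∈ Set.Icc (0 : ℝ) 1, z₁ + v * (z₂ - z₁) ∈ Z := fun v hv => by
    simpa using hZconv.add_smul_sub_mem h₁ h₂ hv
  have hf : ∀ v ∈ Set.Icc (0 : ℝ) 1, HasDerivAt (fun v => deriv μ (z₁ + v * (z₂ - z₁)))
      (deriv (deriv μ) (z₁ + v * (z₂ - z₁)) * (z₂ - z₁)) v := fun v hv => by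
    have hl : HasDerivAt (fun v : ℝ => z₁ + v * (z₂ - z₁)) (z₂ - z₁) v := by
      simpa using ((hasDerivAt_id v).mul_const (z₂ - z₁)).const_add z₁
    exact (hd2 _ (hmem v hv)).hasDerivAt.comp v hl
  have hf' : ∀ v ∈ Set.Icc (0 : ℝ) 1,
      |deriv (deriv μ) (z₁ + v * (z₂ - z₁)) * (z₂ - z₁)| ≤
        R * |z₁ - z₂| * deriv μ (z₁ + v * (z₂ - z₁)) := fun v hv => by
    rw [abs_mul, abs_sub_comm z₂ z₁, mul_right_comm]
    exact mul_le_mul_of_nonneg_right (hsc _ (hmem v hv)) (abs_nonneg _)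
  rcases hz with rfl | rfl
  · simpa using left_le_one_add_mul_integral_of_abs_deriv_le hf hf'
  · have hs : ∀ v ∈ Set.Icc (0 : ℝ) 1, 1 - v ∈ Set.Icc (0 : ℝ) 1 := fun v hv =>
      ⟨sub_nonneg.mpr hv.2, sub_le_self _ hv.1⟩
    have key := left_le_one_add_mul_integral_of_abs_deriv_le
      (fun v hv => (hf (1 - v) (hs v hv)).comp_const_sub 1 v)
      (fun v hv => by rw [abs_neg]; exact hf' (1 - v) (hs v hv))
    rw [intervalIntegral.integral_comp_sub_left
      (fun v => deriv μ (z₁ + v * (z - z₁))) 1] at key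
    simpa using key
end

section
/- Let Z ⊆ ℝ be an interval, R ≥ 0, and let μ : ℝ → ℝ be nondecreasing and R-self-concordant on Z. Then for all a, b ∈ Z, μ̇(a) ≤ μ̇(b) + R·|μ(a) − μ(b)|. -/
/-- Slope-transfer inequality: if `Z` is an interval, `R ≥ 0`, and `μ : ℝ → ℝ` is
nondecreasing and `R`-self-concordant on `Z` (twice differentiable on `Z` with
`|μ''| ≤ R·μ'` on `Z`), then for all `a, b ∈ Z`, `μ'(a) ≤ μ'(b) + R·|μ(a) − μ(b)|`. -/
theorem slope_transfer
    (Z : Set ℝ) (hZconv : Convex ℝ Z) (R : ℝ) (hR : 0 ≤ R)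
    (μ : ℝ → ℝ) (hmono : Monotone μ)
    (hd1 : ∀ z ∈ Z, DifferentiableAt ℝ μ z)
    (hd2 : ∀ z ∈ Z, DifferentiableAt ℝ (deriv μ) z)
    (hsc : ∀ z ∈ Z, |deriv (deriv μ) z| ≤ R * deriv μ z)
    (a : ℝ) (ha : a ∈ Z) (b : ℝ) (hb : b ∈ Z) :
    deriv μ a ≤ deriv μ b + R * |μ a - μ b| := by
  have hadd : ∀ z ∈ Z, HasDerivAt (fun x => R * μ x + deriv μ x)
      (R * deriv μ z + deriv (deriv μ) z) z := fun z hz =>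
    ((hd1 z hz).hasDerivAt.const_mul R).add (hd2 z hz).hasDerivAt
  have hsub : ∀ z ∈ Z, HasDerivAt (fun x => R * μ x - deriv μ x)
      (R * deriv μ z - deriv (deriv μ) z) z := fun z hz =>
    ((hd1 z hz).hasDerivAt.const_mul R).sub (hd2 z hz).hasDerivAt
  have hadd_mono : MonotoneOn (fun x => R * μ x + deriv μ x) Z :=
    monotoneOn_of_hasDerivWithinAt_nonneg hZconv
      (fun z hz => (hadd z hz).continuousAt.continuousWithinAt)
      (fun z hz => (hadd z (interior_subset hz)).hasDerivWithinAt)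
      (fun z hz => by linarith [(abs_le.mp (hsc z (interior_subset hz))).1])
  have hsub_mono : MonotoneOn (fun x => R * μ x - deriv μ x) Z :=
    monotoneOn_of_hasDerivWithinAt_nonneg hZconv
      (fun z hz => (hsub z hz).continuousAt.continuousWithinAt)
      (fun z hz => (hsub z (interior_subset hz)).hasDerivWithinAt)
      (fun z hz => by linarith [(abs_le.mp (hsc z (interior_subset hz))).2])
  rcases le_total a b with h | h
  · have := hadd_mono ha hb h
    have := mul_le_mul_of_nonneg_left (neg_le_abs (μ a - μ b)) hR
    simp only at *
    linarith
  · have := hsub_mono hb ha h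
    have := mul_le_mul_of_nonneg_left (le_abs_self (μ a - μ b)) hR
    simp only at *
    linarith
end
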